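/- The quadratic form φ ↦ ⟨(ξ₁+u)φ²⟩ restricted to the span of {X₊, X₀, X₋} has, in this orthonormal basis, the diagonal matrix diag(u+c, u, u−c) with c = √(5/3). In particular this matrix is degenerate if and only if u ∈ {−c, 0, c}. -/

import Mathlib

open MeasureTheory Real

local notation "E3" => EuclideanSpace ℝ (Fin 3)

/-- One-dimensional standard Gaussian density. -/
noncomputable def gw (x : ℝ) : ℝ := (√(2 * π))⁻¹ * Real.exp (-x ^ 2 / 2)

lemma gw_int (n : ℕ) : Integrable (fun x : ℝ => x ^ n * gw x) := by
  have h := (integrable_rpow_mul_exp_neg_mul_sq (b := 1 / 2) (by norm_num) (s := (n : ℝ))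
    (by have : (0 : ℝ) ≤ n := n.cast_nonneg
        linarith)).const_mul (√(2 * π))⁻¹
  refine h.congr (Filter.Eventually.of_forall fun x => ?_)
  simp only [gw, Real.rpow_natCast]
  rw [show -(1 / 2 : ℝ) * x ^ 2 = -x ^ 2 / 2 by ring]
  ring

lemma gw_deriv (x : ℝ) : HasDerivAt gw (-x * gw x) x := by
  have h : HasDerivAt (fun x : ℝ => -x ^ 2 / 2) (-x) x := by
    have := ((hasDerivAt_pow 2 x).neg).div_const 2
    refine HasDerivAt.congr_deriv this ?_
    simp
    ring
  have := (h.exp).const_mul (√(2 * π))⁻¹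
  refine HasDerivAt.congr_deriv this ?_
  simp only [gw]
  ring

lemma gw_m0 : ∫ x : ℝ, x ^ 0 * gw x = 1 := by
  have h := integral_gaussian (1 / 2)
  have e : (fun x : ℝ => x ^ 0 * gw x) =
      fun x => (√(2 * π))⁻¹ * Real.exp (-(1 / 2) * x ^ 2) := by
    funext x
    simp only [gw]
    rw [show -(1 / 2 : ℝ) * x ^ 2 = -x ^ 2 / 2 by ring]
    ring
  rw [e, integral_const_mul, h, show π / (1 / 2) = 2 * π by ring]
  have : 0 < √(2 * π) := Real.sqrt_pos.2 (by positivity)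
  field_simp

lemma gw_m1 : ∫ x : ℝ, x ^ 1 * gw x = 0 := by
  have h := integral_eq_zero_of_hasDerivAt_of_integrable (f := gw) (f' := fun x => -x * gw x)
    gw_deriv (by simpa using (gw_int 1).neg) (by simpa using gw_int 0)
  simp only [neg_mul, integral_neg, neg_eq_zero] at h
  simpa using h

lemma gw_rec (n : ℕ) :
    ∫ x : ℝ, x ^ (n + 2) * gw x = (n + 1) * ∫ x : ℝ, x ^ n * gw x := by
  have i1 : Integrable (fun x : ℝ => ((n : ℝ) + 1) * (x ^ n * gw x)) := (gw_int n).const_mul _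
  have i2 := gw_int (n + 2)
  have h := integral_eq_zero_of_hasDerivAt_of_integrable (f := fun x : ℝ => x ^ (n + 1) * gw x)
    (f' := fun x => ((n : ℝ) + 1) * (x ^ n * gw x) - x ^ (n + 2) * gw x)
    (fun x => by
      have := (hasDerivAt_pow (n + 1) x).mul (gw_deriv x)
      refine HasDerivAt.congr_deriv this ?_
      push_cast
      ring)
    (i1.sub i2) (gw_int (n + 1))
  rw [integral_sub i1 i2, integral_const_mul] at h
  linarith

lemma gw_m2 : ∫ x : ℝ, x ^ 2 * gw x = 1 := by
  rw [gw_rec 0, gw_m0]; norm_num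
lemma gw_m3 : ∫ x : ℝ, x ^ 3 * gw x = 0 := by
  rw [gw_rec 1, gw_m1]; norm_num
lemma gw_m4 : ∫ x : ℝ, x ^ 4 * gw x = 3 := by
  rw [gw_rec 2, gw_m2]; norm_num
lemma gw_m5 : ∫ x : ℝ, x ^ 5 * gw x = 0 := by
  rw [gw_rec 3, gw_m3]; norm_num

/-- Product Gaussian weight. -/
noncomputable def gW (ξ : E3) : ℝ := gw (ξ 0) * gw (ξ 1) * gw (ξ 2)

/-- `f` is integrable against the Gaussian, with integral `v`. -/
def HI (f : E3 → ℝ) (v : ℝ) : Prop :=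
  Integrable (fun ξ => f ξ * gW ξ) ∧ ∫ ξ, f ξ * gW ξ = v

lemma HI.add {f g : E3 → ℝ} {a b : ℝ} (hf : HI f a) (hg : HI g b) :
    HI (fun ξ => f ξ + g ξ) (a + b) := by
  refine ⟨?_, ?_⟩
  · simp only [add_mul]
    exact hf.1.add hg.1
  · simp only [add_mul]
    rw [integral_add hf.1 hg.1, hf.2, hg.2]

lemma HI.smul {f : E3 → ℝ} {a : ℝ} (k : ℝ) (hf : HI f a) :
    HI (fun ξ => k * f ξ) (k * a) := by
  refine ⟨?_, ?_⟩
  · simpa only [mul_assoc] using hf.1.const_mul k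
  · simp only [mul_assoc]
    rw [integral_const_mul, hf.2]

lemma HI.of_eq {f g : E3 → ℝ} {a b : ℝ} (hf : HI f a) (h : ∀ ξ, g ξ = f ξ) (hab : b = a) :
    HI g b := by
  obtain rfl : g = f := funext h
  rw [hab]; exact hf

lemma HI.mono (a b c : ℕ) : HI (fun ξ => ξ 0 ^ a * ξ 1 ^ b * ξ 2 ^ c)
    ((∫ x : ℝ, x ^ a * gw x) * (∫ x : ℝ, x ^ b * gw x) * ∫ x : ℝ, x ^ c * gw x) := by
  let F : Fin 3 → ℝ → ℝ := fun i x => x ^ (![a, b, c] i) * gw x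
  have hF : ∀ i, Integrable (F i) := fun i => gw_int _
  have e : (fun ξ : E3 => ξ 0 ^ a * ξ 1 ^ b * ξ 2 ^ c * gW ξ) =
      (fun x : Fin 3 → ℝ => ∏ i, F i (x i)) ∘ (WithLp.ofLp : E3 → Fin 3 → ℝ) := by
    funext ξ
    simp [F, gW, Fin.prod_univ_three]
    ring
  have mp := EuclideanSpace.volume_preserving_symm_measurableEquiv_toLp (Fin 3)
  have me := (MeasurableEquiv.toLp 2 (Fin 3 → ℝ)).symm.measurableEmbedding
  refine ⟨?_, ?_⟩
  · rw [e]
    exact (mp.integrable_comp_emb me).2 (Integrable.fintype_prod_dep hF)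
  · rw [e]
    have h1 := mp.integral_comp me (fun x : Fin 3 → ℝ => ∏ i, F i (x i))
    refine h1.trans ?_
    rw [integral_fintype_prod_volume_eq_prod]
    simp [F, Fin.prod_univ_three]

lemma nsq (ξ : E3) : ‖ξ‖ ^ 2 = ξ 0 ^ 2 + ξ 1 ^ 2 + ξ 2 ^ 2 := by
  rw [EuclideanSpace.norm_sq_eq]
  simp [Fin.sum_univ_three]

lemma HI.s0 : HI (fun _ => 1) 1 := (HI.mono 0 0 0).of_eq (by simp) (by simp only [gw_m0]; norm_num)
lemma HI.s1 : HI (fun ξ => ξ 0) 0 :=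
  (HI.mono 1 0 0).of_eq (by simp) (by simp only [gw_m0, gw_m1]; norm_num)
lemma HI.s2 : HI (fun ξ => ξ 0 ^ 2) 1 :=
  (HI.mono 2 0 0).of_eq (by simp) (by simp only [gw_m0, gw_m2]; norm_num)
lemma HI.s3 : HI (fun ξ => ξ 0 ^ 3) 0 :=
  (HI.mono 3 0 0).of_eq (by simp) (by simp only [gw_m0, gw_m3]; norm_num)

lemma HI.q (a : ℕ) : HI (fun ξ => ξ 0 ^ a * ‖ξ‖ ^ 2)
    ((∫ x : ℝ, x ^ (a + 2) * gw x) + 2 * ∫ x : ℝ, x ^ a * gw x) := by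
  refine (((HI.mono (a + 2) 0 0).add (HI.mono a 2 0)).add (HI.mono a 0 2)).of_eq ?_ ?_
  · intro ξ
    rw [nsq]; ring
  · simp only [gw_m0, gw_m2]; ring

lemma HI.qq (a : ℕ) : HI (fun ξ => ξ 0 ^ a * ‖ξ‖ ^ 4)
    ((∫ x : ℝ, x ^ (a + 4) * gw x) + 4 * (∫ x : ℝ, x ^ (a + 2) * gw x)
      + 8 * ∫ x : ℝ, x ^ a * gw x) := by
  refine ((((((HI.mono (a + 4) 0 0).add (HI.mono a 4 0)).add (HI.mono a 0 4)).add
    ((HI.mono (a + 2) 2 0).smul 2)).add ((HI.mono (a + 2) 0 2).smul 2)).add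
    ((HI.mono a 2 2).smul 2)).of_eq ?_ ?_
  · intro ξ
    rw [show ‖ξ‖ ^ 4 = (‖ξ‖ ^ 2) ^ 2 by ring, nsq]; ring
  · simp only [gw_m0, gw_m2, gw_m4]; ring

lemma HI.main (u α β γ α₂ β₂ γ₂ : ℝ) :
    HI (fun ξ => (ξ 0 + u) * (α * ‖ξ‖ ^ 2 + β * ξ 0 + γ) * (α₂ * ‖ξ‖ ^ 2 + β₂ * ξ 0 + γ₂))
      (u * (15 * (α * α₂) + 3 * (α * γ₂ + γ * α₂) + β * β₂ + γ * γ₂)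
        + 5 * (α * β₂ + β * α₂) + (β * γ₂ + γ * β₂)) := by
  refine ((((((((((HI.qq 0).smul (u * α * α₂)).add ((HI.qq 1).smul (α * α₂))).add
    ((HI.q 0).smul (u * (α * γ₂ + γ * α₂)))).add
    ((HI.q 1).smul (u * (α * β₂ + β * α₂) + (α * γ₂ + γ * α₂)))).add
    ((HI.q 2).smul (α * β₂ + β * α₂))).add
    (HI.s0.smul (u * γ * γ₂))).add
    (HI.s1.smul (u * (β * γ₂ + γ * β₂) + γ * γ₂))).add
    (HI.s2.smul (u * β * β₂ + (β * γ₂ + γ * β₂)))).add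
    (HI.s3.smul (β * β₂))).of_eq ?_ ?_
  · intro ξ
    ring
  · simp only [Nat.zero_add, Nat.reduceAdd, gw_m0, gw_m1, gw_m2, gw_m3, gw_m4, gw_m5]; ring

lemma gW_eq (ξ : E3) : (2 * π) ^ (-(3:ℝ)/2) * Real.exp (-‖ξ‖^2 / 2) = gW ξ := by
  have hp : (0 : ℝ) < 2 * π := by positivity
  have h : (2 * π) ^ (-(3:ℝ)/2) = (√(2 * π))⁻¹ ^ 3 := by
    rw [Real.sqrt_eq_rpow, ← Real.rpow_neg hp.le, ← Real.rpow_natCast, ← Real.rpow_mul hp.le]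
    norm_num
  have h2 : Real.exp (-‖ξ‖^2 / 2) =
      Real.exp (-ξ 0 ^ 2 / 2) * Real.exp (-ξ 1 ^ 2 / 2) * Real.exp (-ξ 2 ^ 2 / 2) := by
    rw [← Real.exp_add, ← Real.exp_add, nsq]
    congr 1; ring
  rw [h, h2]
  simp only [gw, gW]
  ring

/-- In the orthonormal basis `(X₊, X₀, X₋)`, the quadratic form
`φ ↦ ⟨(ξ₁+u)φ²⟩` has matrix `diag(u+c, u, u−c)` with `c = √(5/3)`, and this
matrix is degenerate iff `u ∈ {−c, 0, c}`. -/
theorem quadratic_form_matrix_diag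
    (M : E3 → ℝ) (hM : ∀ ξ, M ξ = (2 * π) ^ (-(3:ℝ)/2) * Real.exp (-‖ξ‖^2 / 2))
    (B : Fin 3 → E3 → ℝ)
    (hB0 : ∀ ξ, B 0 ξ = (‖ξ‖^2 + Real.sqrt 15 * ξ 0) / Real.sqrt 30)
    (hB1 : ∀ ξ, B 1 ξ = (‖ξ‖^2 - 5) / Real.sqrt 10)
    (hB2 : ∀ ξ, B 2 ξ = (‖ξ‖^2 - Real.sqrt 15 * ξ 0) / Real.sqrt 30)
    (u c : ℝ) (hc : c = Real.sqrt (5/3)) :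
    (∀ i j : Fin 3,
      (∫ ξ : E3, (ξ 0 + u) * B i ξ * B j ξ * M ξ) =
        Matrix.diagonal ![u + c, u, u - c] i j) ∧
    ((Matrix.diagonal ![u + c, u, u - c]).det = 0 ↔ (u = -c ∨ u = 0 ∨ u = c)) := by
  have e30 : (√30)⁻¹ * (√30)⁻¹ = 1 / 30 := by
    rw [← mul_inv, Real.mul_self_sqrt (by norm_num)]; norm_num
  have e10 : (√10)⁻¹ * (√10)⁻¹ = 1 / 10 := by
    rw [← mul_inv, Real.mul_self_sqrt (by norm_num)]; norm_num
  have e15 : √15 * √15 = 15 := Real.mul_self_sqrt (by norm_num)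
  have ec : c = √15 / 3 := by
    rw [hc, Real.sqrt_eq_iff_mul_self_eq (by norm_num) (by positivity)]
    nlinarith
  obtain ⟨r, hr⟩ : ∃ r, r = (√30)⁻¹ := ⟨_, rfl⟩
  obtain ⟨t, ht⟩ : ∃ t, t = (√10)⁻¹ := ⟨_, rfl⟩
  obtain ⟨s, hs⟩ : ∃ s, s = √15 := ⟨_, rfl⟩
  rw [← hr] at e30
  rw [← ht] at e10
  rw [← hs] at e15 ec
  have key : ∀ i, ∀ ξ, B i ξ =
      ![r, t, r] i * ‖ξ‖ ^ 2 + ![r * s, 0, -(r * s)] i * ξ 0 + ![0, -5 * t, 0] i := by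
    intro i ξ
    fin_cases i
    · simp [hB0, hr, hs]; ring
    · simp [hB1, ht]; ring
    · simp [hB2, hr, hs]; ring
  refine ⟨fun i j => ?_, ?_⟩
  · have h := (HI.main u (![r, t, r] i) (![r * s, 0, -(r * s)] i) (![0, -5 * t, 0] i)
      (![r, t, r] j) (![r * s, 0, -(r * s)] j) (![0, -5 * t, 0] j)).2
    simp only [hM, gW_eq, key]
    rw [h]
    fin_cases i <;> fin_cases j <;> simp [Matrix.diagonal, ec] <;> grind
  · rw [Matrix.det_diagonal]
    simp only [Fin.prod_univ_three, mul_eq_zero]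
    simp [add_eq_zero_iff_eq_neg, sub_eq_zero, or_assoc]
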